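/- arXiv:1208.3637 — 2 statements merged into one kernel-verified Lean document; each statement's English description precedes it below -/
import Mathlib

section
/- Let A be the 9×9 adjacency matrix of the '3311 spoke' tree: a central vertex c together with four pairwise disjoint paths attached to c, consisting of 3, 3, 1 and 1 edges respectively. Then √(3+√3) is the largest eigenvalue of A: there exists a nonzero real vector v with A·v = √(3+√3)·v, and every real number μ admitting a nonzero vector w with A·w = μ·w satisfies |μ| ≤ √(3+√3). -/
open Matrix

/-- Edge list of the 3311 spoke tree: central vertex 0 with arms of 3, 3, 1, 1 edges. -/
def edgesSpoke3311 : List (Fin 9 × Fin 9) :=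
  [(0,1),(1,2),(2,3),(0,4),(4,5),(5,6),(0,7),(0,8)]

/-- Adjacency matrix: entry 1 if the vertices are joined by an edge, 0 otherwise. -/
def adjSpoke3311 : Matrix (Fin 9) (Fin 9) ℝ :=
  fun i j => if (i, j) ∈ edgesSpoke3311 ∨ (j, i) ∈ edgesSpoke3311 then 1 else 0

/-- If an entrywise nonnegative real matrix has a strictly positive eigenvector with eigenvalue `l`,
then every real eigenvalue is bounded by `l` in absolute value. -/
theorem abs_eigenvalue_le_of_pos_eigenvector {n : Type*} [Fintype n]
    {A : Matrix n n ℝ} (hA : ∀ i j, 0 ≤ A i j) {v : n → ℝ} (hv : ∀ i, 0 < v i) {l : ℝ}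
    (hAv : A.mulVec v = l • v) {μ : ℝ} {w : n → ℝ} (hw : w ≠ 0) (hAw : A.mulVec w = μ • w) :
    |μ| ≤ l := by
  obtain ⟨k, hk⟩ := Function.ne_iff.mp hw
  have : Nonempty n := ⟨k⟩
  obtain ⟨i, hi⟩ := Finite.exists_max fun j => |w j| / v j
  have hr : 0 < |w i| / v i := (div_pos (abs_pos.mpr hk) (hv k)).trans_le (hi k)
  have hwi : 0 < |w i| := (div_pos_iff_of_pos_right (hv i)).mp hr
  have hle : ∀ j, |w j| ≤ |w i| / v i * v j := fun j => (div_le_iff₀ (hv j)).mp (hi j)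
  have hAwi : ∑ j, A i j * w j = μ * w i := congrFun hAw i
  have hAvi : ∑ j, A i j * v j = l * v i := congrFun hAv i
  refine le_of_mul_le_mul_right ?_ hwi
  calc |μ| * |w i| = |∑ j, A i j * w j| := by rw [hAwi, abs_mul]
    _ ≤ ∑ j, |A i j * w j| := Finset.abs_sum_le_sum_abs _ _
    _ ≤ ∑ j, |w i| / v i * (A i j * v j) := Finset.sum_le_sum fun j _ => by
        rw [abs_mul, abs_of_nonneg (hA i j), mul_left_comm]
        exact mul_le_mul_of_nonneg_left (hle j) (hA i j)
    _ = l * |w i| := by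
        have := (hv i).ne'
        rw [← Finset.mul_sum, hAvi]
        field_simp

theorem adjSpoke3311_nonneg (i j : Fin 9) : 0 ≤ adjSpoke3311 i j := by
  unfold adjSpoke3311
  split_ifs <;> norm_num

/-- The Perron–Frobenius eigenvector of the 3311 spoke tree, as a function of the eigenvalue. -/
def perronSpoke3311 (x : ℝ) : Fin 9 → ℝ :=
  ![x ^ 3 - 2 * x, x ^ 2 - 1, x, 1, x ^ 2 - 1, x, 1, x ^ 2 - 2, x ^ 2 - 2]

theorem perronSpoke3311_pos {x : ℝ} (hx : 0 < x) (hx2 : 2 < x ^ 2) (i : Fin 9) :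
    0 < perronSpoke3311 x i := by
  have h0 : 0 < x ^ 3 - 2 * x := by nlinarith
  fin_cases i <;> simp [perronSpoke3311, -sub_pos, -one_lt_sq_iff_one_lt_abs] <;> linarith

theorem adjSpoke3311_mulVec_perronSpoke3311 {x : ℝ} (hx : x ^ 4 - 6 * x ^ 2 + 6 = 0) :
    adjSpoke3311.mulVec (perronSpoke3311 x) = x • perronSpoke3311 x := by
  ext i
  fin_cases i <;>
    simp [Matrix.mulVec, dotProduct, Fin.sum_univ_succ, adjSpoke3311,
      edgesSpoke3311, perronSpoke3311] <;>
    linarith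

theorem thmSpoke3311 :
    (∃ v : Fin 9 → ℝ, v ≠ 0 ∧ (adjSpoke3311).mulVec v = Real.sqrt (3 + Real.sqrt 3) • v) ∧
    (∀ (μ : ℝ) (w : Fin 9 → ℝ), w ≠ 0 → (adjSpoke3311).mulVec w = μ • w →
      |μ| ≤ Real.sqrt (3 + Real.sqrt 3)) := by
  have h3 : Real.sqrt 3 ^ 2 = 3 := Real.sq_sqrt (by norm_num)
  have h3' : 0 ≤ Real.sqrt 3 := Real.sqrt_nonneg 3
  have hsq : Real.sqrt (3 + Real.sqrt 3) ^ 2 = 3 + Real.sqrt 3 := Real.sq_sqrt (by positivity)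
  have hpos : 0 < Real.sqrt (3 + Real.sqrt 3) := Real.sqrt_pos.mpr (by positivity)
  set x := Real.sqrt (3 + Real.sqrt 3)
  have hv := perronSpoke3311_pos hpos (by linarith)
  have hAv : adjSpoke3311.mulVec (perronSpoke3311 x) = x • perronSpoke3311 x :=
    adjSpoke3311_mulVec_perronSpoke3311 <| by
      rw [show x ^ 4 = (x ^ 2) ^ 2 by ring, hsq]
      linarith
  exact ⟨⟨_, fun h => (hv 0).ne' (congrFun h 0), hAv⟩,
    fun _ _ hw hAw => abs_eigenvalue_le_of_pos_eigenvector adjSpoke3311_nonneg hv hAv hw hAw⟩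
end

section
/- Let A be the adjacency matrix of the graph obtained from the 4442 base graph by adding four new vertices w₁, w₁′, w₂, w₃, where w₁ and w₁′ are each adjacent to u₁, w₂ is adjacent to u₂, and w₃ is adjacent to u₃. Then A has an eigenvalue strictly larger than √(3+√5): there exist a real number μ > √(3+√5) and a nonzero real vector v with A·v = μ·v. -/
open Matrix

/-- 4442 base graph plus vertices 8,9 adjacent to 5, vertex 10 adjacent to 6, vertex 11 adjacent to 7. -/
def edgesSplit4442 : List (Fin 12 × Fin 12) :=
  [(0,1),(1,2),(2,3),(3,4),(4,5),(4,6),(4,7),(5,8),(5,9),(6,10),(7,11)]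

/-- Adjacency matrix: entry 1 if the vertices are joined by an edge, 0 otherwise. -/
def adjSplit4442 : Matrix (Fin 12) (Fin 12) ℝ :=
  fun i j => if (i, j) ∈ edgesSplit4442 ∨ (j, i) ∈ edgesSplit4442 then 1 else 0

/-- A polynomial whose roots `x` with `x ^ 2 ≠ 1, 2` are eigenvalues of `adjSplit4442`. -/
def eigenPolySplit4442 (x : ℝ) : ℝ :=
  (x ^ 4 - 3 * x ^ 2 + 1) * (x ^ 2 - 2) * (x ^ 2 - 1) - (x ^ 2 - 2) ^ 2 * (x ^ 2 - 1)
    - (x ^ 4 - 3 * x ^ 2 + 1) * (x ^ 2 - 1) - 2 * (x ^ 4 - 3 * x ^ 2 + 1) * (x ^ 2 - 2)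

/-- The candidate eigenvector of `adjSplit4442` for the eigenvalue `x`. -/
def eigenvectorSplit4442 (x : ℝ) : Fin 12 → ℝ :=
  let s := (x ^ 2 - 2) * (x ^ 2 - 1)
  let d := x ^ 4 - 3 * x ^ 2 + 1
  ![s, x * s, (x ^ 2 - 1) * s, x * (x ^ 2 - 2) * s, d * s,
    d * x * (x ^ 2 - 1), d * x * (x ^ 2 - 2), d * x * (x ^ 2 - 2),
    d * (x ^ 2 - 1), d * (x ^ 2 - 1), d * (x ^ 2 - 2), d * (x ^ 2 - 2)]

theorem adjSplit4442_mulVec_eigenvector {x : ℝ} (hx : eigenPolySplit4442 x = 0) :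
    adjSplit4442.mulVec (eigenvectorSplit4442 x) = x • eigenvectorSplit4442 x := by
  unfold eigenPolySplit4442 at hx
  ext i
  fin_cases i <;>
    simp [Matrix.mulVec, dotProduct, Fin.sum_univ_succ, adjSplit4442, edgesSplit4442,
      eigenvectorSplit4442] <;>
    first
    | ring1
    | linear_combination (-x) * hx

theorem exists_root_eigenPolySplit4442 :
    ∃ x : ℝ, 2.3 ≤ x ∧ eigenPolySplit4442 x = 0 := by
  have hcont : ContinuousOn eigenPolySplit4442 (Set.Icc 2.3 2.4) := by
    unfold eigenPolySplit4442
    fun_prop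
  obtain ⟨x, hx, hroot⟩ := intermediate_value_Icc (by norm_num) hcont
    (show (0 : ℝ) ∈ Set.Icc _ _ by constructor <;> norm_num [eigenPolySplit4442])
  exact ⟨x, hx.1, hroot⟩

theorem sqrt_three_add_sqrt_five_lt : Real.sqrt (3 + Real.sqrt 5) < 2.3 := by
  have h : Real.sqrt 5 < 2.25 := by
    rw [Real.sqrt_lt' (by norm_num)]
    norm_num
  rw [Real.sqrt_lt' (by norm_num)]
  norm_num at h ⊢
  linarith

theorem thmSplit4442 :
    ∃ μ : ℝ, μ > Real.sqrt (3 + Real.sqrt 5) ∧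
      ∃ v : Fin 12 → ℝ, v ≠ 0 ∧ (adjSplit4442).mulVec v = μ • v := by
  obtain ⟨x, hx, hroot⟩ := exists_root_eigenPolySplit4442
  refine ⟨x, sqrt_three_add_sqrt_five_lt.trans_le hx, eigenvectorSplit4442 x, fun h => ?_,
    adjSplit4442_mulVec_eigenvector hroot⟩
  have h0 : (x ^ 2 - 2) * (x ^ 2 - 1) = 0 := congrFun h 0
  have hsq : (2.3 : ℝ) ^ 2 ≤ x ^ 2 := by gcongr
  norm_num at hsq
  have hpos : 0 < (x ^ 2 - 2) * (x ^ 2 - 1) := mul_pos (by linarith) (by linarith)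
  exact hpos.ne' h0
end
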